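/- arXiv:2201.04973 — 4 statements merged into one kernel-verified Lean document; each statement's English description precedes it below -/
import Mathlib

section
/- For all integers l, h ≥ 0 with N = l + h ≥ 1, the Grundy value of the normal-play destined-coins game with an extra genuine coin is G(D^+_{l,h}) = N − 1 (regardless of which coin is counterfeit); equivalently, D^+_{l,h} is equivalent to normal-play Nim with a single pile of size N − 1. -/
/-!
A model of the counterfeit-coin weighing games.

There are `n` coins, indexed by `Fin n`, exactly one of which is counterfeit;
all genuine coins weigh the same, and the counterfeit is lighter or heavier
than a genuine coin according to its `FakeType`.  Each coin carries a
`CoinStatus` recording the Observer's knowledge about it: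

* `excluded`: the Observer knows the coin is genuine;
* `light`   : destined to be lighter (if this coin is the counterfeit, it is lighter);
* `heavy`   : destined to be heavier (if this coin is the counterfeit, it is heavier);
* `unknown` : the coin could be the counterfeit, either lighter or heavier.

Both players know the counterfeit coin and its type, and alternately perform
weighings: two disjoint sets of coins of equal size are put on the two pans of a
balance scale, and the outcome is determined by the truth.  After a balanced
weighing, the coins on the scale become excluded.  After an unbalanced weighing,
the coins off the scale become excluded; a coin on the lighter pan becomes
light-destined unless this contradicts its previous status (a heavy-destined
coin on the lighter pan becomes excluded); symmetrically for the heavier pan;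
excluded coins stay excluded.  A weighing is legal iff the Observer gains some
new information, i.e. some coin changes status.

`Found P` says the Observer has found the counterfeit coin (exactly one coin is
not excluded); `FoundAndIdentified P` says she has moreover identified it as
lighter or heavier.  In the game whose end condition is a goal `goal`, play
stops as soon as the goal is reached (`GMove goal`).  `NormalWin` is the
normal-play winning predicate for the player to move (the player unable to move
loses, so the player making the last legal weighing wins); `MisereWin` is the
misère-play winning predicate (the player whose weighing reveals the full
information, i.e. moves to a goal position, loses); `grundy` is the Grundy
(nim-)value: the `mex` of the Grundy values of the options, a position without
options having Grundy value `0`.  Since every legal weighing strictly decreases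
the total hidden information `info P`, defining these by recursion with fuel
`info P` gives the correct values.
-/

/-- The Observer's knowledge about one coin. -/
inductive CoinStatus : Type
  | excluded : CoinStatus
  | light    : CoinStatus
  | heavy    : CoinStatus
  | unknown  : CoinStatus
  deriving DecidableEq

/-- Whether the counterfeit coin is actually lighter or heavier than a genuine coin. -/
inductive FakeType : Type
  | light : FakeType
  | heavy : FakeType
  deriving DecidableEq

/-- The destiny status corresponding to the true type of the counterfeit coin. -/
def FakeType.destiny : FakeType → CoinStatus
  | FakeType.light => CoinStatus.light
  | FakeType.heavy => CoinStatus.heavy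

/-- A position of the game: the statuses of the coins (the Observer's knowledge)
together with the identity and the true type of the counterfeit coin (which both
players know). -/
structure Position (n : ℕ) : Type where
  status : Fin n → CoinStatus
  counterfeit : Fin n
  fakeType : FakeType

/-- Possible outcomes of a weighing. -/
inductive Outcome : Type
  | balanced | leftLighter | rightLighter
  deriving DecidableEq

/-- The truthful outcome of weighing pan `A` (left) against pan `B` (right):
it is determined by the location and the type of the counterfeit coin. -/
def outcome {n : ℕ} (P : Position n) (A B : Finset (Fin n)) : Outcome :=
  if P.counterfeit ∈ A then
    (match P.fakeType with
      | FakeType.light => Outcome.leftLighter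
      | FakeType.heavy => Outcome.rightLighter)
  else if P.counterfeit ∈ B then
    (match P.fakeType with
      | FakeType.light => Outcome.rightLighter
      | FakeType.heavy => Outcome.leftLighter)
  else Outcome.balanced

/-- New status of a coin that lay on the lighter pan of an unbalanced weighing. -/
def onLighterPan : CoinStatus → CoinStatus
  | CoinStatus.excluded => CoinStatus.excluded
  | CoinStatus.heavy => CoinStatus.excluded
  | _ => CoinStatus.light

/-- New status of a coin that lay on the heavier pan of an unbalanced weighing. -/
def onHeavierPan : CoinStatus → CoinStatus
  | CoinStatus.excluded => CoinStatus.excluded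
  | CoinStatus.light => CoinStatus.excluded
  | _ => CoinStatus.heavy

/-- The statuses after weighing `A` against `B`. -/
def updateStatus {n : ℕ} (P : Position n) (A B : Finset (Fin n)) (i : Fin n) :
    CoinStatus :=
  match outcome P A B with
  | Outcome.balanced =>
      if i ∈ A ∨ i ∈ B then CoinStatus.excluded else P.status i
  | Outcome.leftLighter =>
      if i ∈ A then onLighterPan (P.status i)
      else if i ∈ B then onHeavierPan (P.status i)
      else CoinStatus.excluded
  | Outcome.rightLighter =>
      if i ∈ B then onLighterPan (P.status i)
      else if i ∈ A then onHeavierPan (P.status i)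
      else CoinStatus.excluded

/-- The position obtained from `P` by weighing pan `A` against pan `B`. -/
def weigh {n : ℕ} (P : Position n) (A B : Finset (Fin n)) : Position n :=
  ⟨updateStatus P A B, P.counterfeit, P.fakeType⟩

/-- `Move P Q`: `Q` is obtained from `P` by one legal weighing, i.e. the two
pans are disjoint and carry equally many coins, and the Observer gains some new
information (some coin changes status). -/
def Move {n : ℕ} (P Q : Position n) : Prop :=
  ∃ A B : Finset (Fin n), Disjoint A B ∧ A.card = B.card ∧
    updateStatus P A B ≠ P.status ∧ Q = weigh P A B

/-- The set of coins currently having status `s`. -/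
def statusSet {n : ℕ} (P : Position n) (s : CoinStatus) : Finset (Fin n) :=
  Finset.univ.filter fun i => P.status i = s

/-- The set of coins not yet known to be genuine. -/
def nonExcluded {n : ℕ} (P : Position n) : Finset (Fin n) :=
  Finset.univ.filter fun i => P.status i ≠ CoinStatus.excluded

/-- The number of unknown coins. -/
def unknownCount {n : ℕ} (P : Position n) : ℕ :=
  (statusSet P CoinStatus.unknown).card

/-- The number of destined coins. -/
def destinedCount {n : ℕ} (P : Position n) : ℕ :=
  (statusSet P CoinStatus.light).card + (statusSet P CoinStatus.heavy).card

/-- The number of coins sharing the counterfeit coin's status, counting the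
counterfeit coin itself. -/
def sameDestinyCount {n : ℕ} (P : Position n) : ℕ :=
  (Finset.univ.filter fun i => P.status i = P.status P.counterfeit).card

/-- The Observer has found the counterfeit coin: exactly one coin is not excluded. -/
def Found {n : ℕ} (P : Position n) : Prop := (nonExcluded P).card = 1

/-- The Observer has found the counterfeit coin and knows whether it is lighter
or heavier. -/
def FoundAndIdentified {n : ℕ} (P : Position n) : Prop :=
  Found P ∧ P.status P.counterfeit ≠ CoinStatus.unknown

/-- Moves in the game whose end condition is `goal`: the game stops as soon as
the Observer's goal is reached, so no further weighings happen after that. -/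
def GMove {n : ℕ} (goal : Position n → Prop) (P Q : Position n) : Prop :=
  ¬ goal P ∧ Move P Q

/-- The amount of information about one coin still hidden from the Observer. -/
def statusWeight : CoinStatus → ℕ
  | CoinStatus.excluded => 0
  | CoinStatus.unknown => 2
  | _ => 1

/-- The total information still hidden from the Observer.  Every legal weighing
strictly decreases it, so it bounds the number of remaining moves. -/
def info {n : ℕ} (P : Position n) : ℕ := ∑ i, statusWeight (P.status i)

/-- Normal-play winning predicate, computed with fuel. -/
def NormalWinAux {n : ℕ} (moveRel : Position n → Position n → Prop) :
    ℕ → Position n → Prop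
  | 0, _ => False
  | k + 1, P => ∃ Q, moveRel P Q ∧ ¬ NormalWinAux moveRel k Q

/-- The player to move wins under normal play: a player who has no legal move
loses (so the player making the last legal weighing wins).  The fuel `info P`
suffices since every legal weighing strictly decreases `info`. -/
def NormalWin {n : ℕ} (moveRel : Position n → Position n → Prop)
    (P : Position n) : Prop :=
  NormalWinAux moveRel (info P) P

/-- Misère-play winning predicate, computed with fuel. -/
def MisereWinAux {n : ℕ} (moveRel : Position n → Position n → Prop)
    (goal : Position n → Prop) : ℕ → Position n → Prop
  | 0, P => goal P
  | k + 1, P => goal P ∨ ∃ Q, moveRel P Q ∧ ¬ MisereWinAux moveRel goal k Q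

/-- The player to move wins under misère play: the player whose weighing
reveals the full information to the Observer (i.e. moves to a position
satisfying `goal`) loses; equivalently, the player to move at a goal position
has already won.  A position is a P-position iff `MisereWin` fails there. -/
def MisereWin {n : ℕ} (moveRel : Position n → Position n → Prop)
    (goal : Position n → Prop) (P : Position n) : Prop :=
  MisereWinAux moveRel goal (info P) P

/-- Minimum excludant of a set of naturals. -/
noncomputable def mex (s : Set ℕ) : ℕ := sInf {k : ℕ | k ∉ s}

/-- Grundy values, computed with fuel. -/
noncomputable def grundyAux {n : ℕ} (moveRel : Position n → Position n → Prop) :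
    ℕ → Position n → ℕ
  | 0, _ => 0
  | k + 1, P => mex {g : ℕ | ∃ Q, moveRel P Q ∧ grundyAux moveRel k Q = g}

/-- The Grundy (nim-)value of a position: the `mex` of the Grundy values of the
positions reachable in one legal move; a position with no legal move has Grundy
value `0`.  The fuel `info P` suffices since every legal weighing strictly
decreases `info`. -/
noncomputable def grundy {n : ℕ} (moveRel : Position n → Position n → Prop)
    (P : Position n) : ℕ :=
  grundyAux moveRel (info P) P

/-- A consistent position without unknown coins in which some coin is known to be genuine. -/
structure DestinedExtra {n : ℕ} (P : Position n) : Prop where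
  status_ne_unknown : ∀ i, P.status i ≠ CoinStatus.unknown
  status_counterfeit : P.status P.counterfeit = P.fakeType.destiny
  exists_excluded : ∃ i, P.status i = CoinStatus.excluded

theorem FakeType.destiny_ne_excluded (t : FakeType) : t.destiny ≠ CoinStatus.excluded := by
  cases t <;> simp [FakeType.destiny]

theorem mex_setOf_lt (m : ℕ) : mex {g | g < m} = m := by
  have : {k : ℕ | k ∉ {g | g < m}} = Set.Ici m := by
    ext k
    simp
  rw [mex, this, csInf_Ici]

theorem onLighterPan_eq {s : CoinStatus} (hs : s ≠ CoinStatus.unknown) :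
    onLighterPan s = CoinStatus.excluded ∨ onLighterPan s = s := by
  cases s <;> simp_all [onLighterPan]

theorem onHeavierPan_eq {s : CoinStatus} (hs : s ≠ CoinStatus.unknown) :
    onHeavierPan s = CoinStatus.excluded ∨ onHeavierPan s = s := by
  cases s <;> simp_all [onHeavierPan]

/-- A destined coin either keeps its status or becomes excluded. -/
theorem updateStatus_eq {n : ℕ} {P : Position n} (A B : Finset (Fin n)) {i : Fin n}
    (hi : P.status i ≠ CoinStatus.unknown) :
    updateStatus P A B i = CoinStatus.excluded ∨ updateStatus P A B i = P.status i := by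
  have hL := onLighterPan_eq hi
  have hH := onHeavierPan_eq hi
  unfold updateStatus
  cases outcome P A B <;> grind

theorem updateStatus_counterfeit {n : ℕ} {P : Position n} {A B : Finset (Fin n)}
    (hAB : Disjoint A B) (hcf : P.status P.counterfeit = P.fakeType.destiny) :
    updateStatus P A B P.counterfeit = P.status P.counterfeit := by
  have hd : P.counterfeit ∈ A → P.counterfeit ∉ B := fun h => Finset.disjoint_left.mp hAB h
  unfold updateStatus outcome
  by_cases hA : P.counterfeit ∈ A <;> by_cases hB : P.counterfeit ∈ B <;>
    cases hf : P.fakeType <;>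
    simp_all [FakeType.destiny, onLighterPan, onHeavierPan]

namespace DestinedExtra

variable {n : ℕ} {P Q : Position n}

theorem counterfeit_mem (hP : DestinedExtra P) : P.counterfeit ∈ nonExcluded P := by
  simp [nonExcluded, hP.status_counterfeit, FakeType.destiny_ne_excluded]

theorem move (hP : DestinedExtra P) (hQ : Move P Q) : DestinedExtra Q := by
  obtain ⟨A, B, hAB, -, -, rfl⟩ := hQ
  refine ⟨fun i => ?_, (updateStatus_counterfeit hAB hP.status_counterfeit).trans
    hP.status_counterfeit, ?_⟩
  · have h := updateStatus_eq A B (hP.status_ne_unknown i)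
    have hi := hP.status_ne_unknown i
    simp only [weigh]
    grind
  · obtain ⟨e, he⟩ := hP.exists_excluded
    have h := updateStatus_eq A B (hP.status_ne_unknown e)
    exact ⟨e, by simpa [weigh, he] using h⟩

theorem card_lt_of_move (hP : DestinedExtra P) (hQ : Move P Q) :
    (nonExcluded Q).card < (nonExcluded P).card := by
  obtain ⟨A, B, -, -, hne, rfl⟩ := hQ
  obtain ⟨j, hj⟩ := Function.ne_iff.mp hne
  have hup := fun i => updateStatus_eq A B (hP.status_ne_unknown i)
  refine Finset.card_lt_card (Finset.ssubset_iff_of_subset ?_ |>.mpr ⟨j, ?_, ?_⟩)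
  · intro i
    have := hup i
    simp only [nonExcluded, weigh, Finset.mem_filter_univ]
    grind
  · have := hup j
    simp only [nonExcluded, Finset.mem_filter_univ]
    grind
  · have := hup j
    simp only [nonExcluded, weigh]
    grind

/-- Weighing the coins of an even set not containing the counterfeit against each other excludes
exactly these coins. -/
theorem exists_move_sdiff {T : Finset (Fin n)} (hT : Even T.card) (hc : P.counterfeit ∉ T)
    (hex : (T ∩ nonExcluded P).Nonempty) :
    ∃ Q, Move P Q ∧ nonExcluded Q = nonExcluded P \ T := by
  obtain ⟨r, hr⟩ := hT
  obtain ⟨A, hA, hAr⟩ := Finset.exists_subset_card_eq (show r ≤ T.card by omega)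
  have hmem : ∀ i, (i ∈ A ∨ i ∈ T \ A) ↔ i ∈ T := fun i => by
    have := @hA i
    simp only [Finset.mem_sdiff]
    tauto
  have hup : ∀ i, updateStatus P A (T \ A) i =
      if i ∈ T then CoinStatus.excluded else P.status i := fun i => by
    have hout : outcome P A (T \ A) = Outcome.balanced := by
      have := (hmem P.counterfeit).not.mpr hc
      rw [not_or] at this
      simp [outcome, this.1, hc]
    simp only [updateStatus, hout, hmem]
  refine ⟨_, ⟨A, T \ A, Finset.disjoint_sdiff, ?_, fun h => ?_, rfl⟩, ?_⟩
  · rw [Finset.card_sdiff_of_subset hA]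
    omega
  · obtain ⟨i, hi⟩ := hex
    rw [Finset.mem_inter] at hi
    have h' := (hup i).symm.trans (congrFun h i)
    simp only [hi.1, if_true] at h'
    exact absurd h'.symm (by simpa [nonExcluded] using hi.2)
  · ext i
    by_cases hi : i ∈ T <;> simp [nonExcluded, weigh, hup, hi]

theorem exists_move_card_eq (hP : DestinedExtra P) {m : ℕ} (hm : 1 ≤ m)
    (hmP : m < (nonExcluded P).card) :
    ∃ Q, Move P Q ∧ (nonExcluded Q).card = m := by
  have hcard := Finset.card_erase_of_mem hP.counterfeit_mem
  obtain ⟨S, hS, hSr⟩ := Finset.exists_subset_card_eq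
    (show (nonExcluded P).card - m ≤ ((nonExcluded P).erase P.counterfeit).card by omega)
  have hSP : S ⊆ nonExcluded P := hS.trans (Finset.erase_subset _ _)
  have hcS : P.counterfeit ∉ S := fun h => Finset.notMem_erase _ _ (hS h)
  obtain ⟨i, hi⟩ := Finset.card_pos.mp (show 0 < S.card by omega)
  obtain ⟨e, he⟩ := hP.exists_excluded
  have heP : e ∉ nonExcluded P := by simp [nonExcluded, he]
  have heS : e ∉ S := fun h => heP (hSP h)
  have hdiff : (nonExcluded P \ S).card = m := by
    rw [Finset.card_sdiff_of_subset hSP]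
    omega
  rcases Nat.even_or_odd S.card with hev | hodd
  · obtain ⟨Q, hQ, hQS⟩ := exists_move_sdiff hev hcS ⟨i, Finset.mem_inter.mpr ⟨hi, hSP hi⟩⟩
    exact ⟨Q, hQ, by rw [hQS, hdiff]⟩
  · have hev : Even (insert e S).card := by
      rw [Finset.card_insert_of_notMem heS]
      exact hodd.add_one
    have hce : P.counterfeit ∉ insert e S := by
      rw [Finset.mem_insert, not_or]
      exact ⟨fun h => heP (h ▸ hP.counterfeit_mem), hcS⟩
    obtain ⟨Q, hQ, hQS⟩ := exists_move_sdiff hev hce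
      ⟨i, Finset.mem_inter.mpr ⟨Finset.mem_insert_of_mem hi, hSP hi⟩⟩
    refine ⟨Q, hQ, ?_⟩
    rw [hQS, Finset.sdiff_insert, Finset.erase_eq_of_notMem, hdiff]
    exact fun h => heP (Finset.mem_sdiff.mp h).1

theorem grundyAux_eq (k : ℕ) : ∀ {P : Position n}, DestinedExtra P → (nonExcluded P).card ≤ k →
    grundyAux (GMove Found) k P = (nonExcluded P).card - 1 := by
  induction k with
  | zero =>
    intro P _ hk
    simp only [grundyAux]
    omega
  | succ k ih =>
    intro P hP hk
    rw [grundyAux, ← mex_setOf_lt ((nonExcluded P).card - 1)]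
    congr 1
    ext g
    constructor
    · rintro ⟨Q, ⟨-, hQ⟩, rfl⟩
      have hlt := hP.card_lt_of_move hQ
      have hpos := Finset.card_pos.mpr ⟨_, (hP.move hQ).counterfeit_mem⟩
      rw [Set.mem_ofPred_eq, ih (hP.move hQ) (by omega)]
      omega
    · intro hg
      rw [Set.mem_ofPred_eq] at hg
      obtain ⟨Q, hQ, hQg⟩ := hP.exists_move_card_eq (m := g + 1) (by omega) (by omega)
      refine ⟨Q, ⟨fun hf => ?_, hQ⟩, ?_⟩
      · rw [Found] at hf
        omega
      · rw [ih (hP.move hQ) (by omega), hQg, Nat.add_sub_cancel]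

theorem info_eq (hP : DestinedExtra P) : info P = (nonExcluded P).card := by
  rw [info, nonExcluded, Finset.card_filter]
  refine Finset.sum_congr rfl fun i _ => ?_
  have := hP.status_ne_unknown i
  cases h : P.status i <;> simp_all [statusWeight]

theorem card_nonExcluded (hP : DestinedExtra P) :
    (nonExcluded P).card = destinedCount P := by
  rw [destinedCount, statusSet, statusSet, ← Finset.card_union_of_disjoint]
  · congr 1
    ext i
    have := hP.status_ne_unknown i
    cases h : P.status i <;> simp_all [nonExcluded]
  · rw [Finset.disjoint_filter]
    simp_all

theorem grundy_eq (hP : DestinedExtra P) : grundy (GMove Found) P = destinedCount P - 1 := by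
  rw [grundy, grundyAux_eq _ hP hP.info_eq.ge, hP.card_nonExcluded]

end DestinedExtra

/-- For all `l, h ≥ 0` with `N = l + h ≥ 1`, the Grundy value
of the normal-play destined-coins game with one extra genuine coin is
`G(D⁺_{l,h}) = N - 1`, regardless of which coin is counterfeit (i.e. the game
is equivalent to normal-play Nim with a single pile of size `N - 1`). -/
theorem grundy_destined_extra_normal {n l h : ℕ} (P : Position n)
    (hN : 1 ≤ l + h)
    (hl : (statusSet P CoinStatus.light).card = l)
    (hh : (statusSet P CoinStatus.heavy).card = h)
    (he : (statusSet P CoinStatus.excluded).card = 1)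
    (hnu : statusSet P CoinStatus.unknown = ∅)
    (hcf : P.status P.counterfeit = P.fakeType.destiny) :
    grundy (GMove Found) P = l + h - 1 := by
  have hP : DestinedExtra P := by
    refine ⟨fun i hi => ?_, hcf, ?_⟩
    · have : i ∈ statusSet P CoinStatus.unknown := by simpa [statusSet] using hi
      simp [hnu] at this
    · obtain ⟨i, hi⟩ := Finset.card_pos.mp (he.symm ▸ Nat.one_pos)
      exact ⟨i, by simpa [statusSet] using hi⟩
  rw [hP.grundy_eq, destinedCount, hl, hh]
end

section
/- Consider the starting position of the destined-coins game D_{l,h} with l, h ≥ 0, N = l + h ≥ 2 and (l,h) ≠ (1,1), and let c be the number of coins sharing the counterfeit coin's destiny (counting the counterfeit itself). The set S of possible values of the number of non-excluded coins after one legal weighing is exactly: if l = h, then S = {1, 2, …, N−2}; if l ≠ h, then S = ({m : 1 ≤ m ≤ N−2 and m ≡ N (mod 2)} ∪ {m : 1 ≤ m ≤ ⌊N/2⌋ + min(l,h)}) \ E, where E = {1} if N is even and c = 1, and E = ∅ otherwise. -/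
lemma updateStatus_eq_excluded_or {n : ℕ} (P : Position n)
    (hd : ∀ i, P.status i = CoinStatus.light ∨ P.status i = CoinStatus.heavy)
    (A B : Finset (Fin n)) (i : Fin n) :
    updateStatus P A B i = CoinStatus.excluded ∨ updateStatus P A B i = P.status i := by
  unfold updateStatus
  rcases hd i with hi | hi <;> rw [hi] <;> cases outcome P A B <;> dsimp only <;>
    split_ifs <;> simp [onLighterPan, onHeavierPan]

/-- When all coins are destined, a weighing is legal iff it leaves fewer than `n` coins
non-excluded. -/
lemma updateStatus_ne_iff_card_lt {n : ℕ} (P : Position n)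
    (hd : ∀ i, P.status i = CoinStatus.light ∨ P.status i = CoinStatus.heavy)
    (A B : Finset (Fin n)) :
    updateStatus P A B ≠ P.status ↔ (nonExcluded (weigh P A B)).card < n := by
  have hle : (nonExcluded (weigh P A B)).card ≤ n := by
    simpa using Finset.card_le_univ (nonExcluded (weigh P A B))
  rw [← not_iff_not, not_not, not_lt]
  constructor
  · intro h
    have : nonExcluded (weigh P A B) = Finset.univ := by
      ext i
      rcases hd i with hi | hi <;> simp [nonExcluded, weigh, h, hi]
    simp [this]
  · intro h
    have huniv : nonExcluded (weigh P A B) = Finset.univ :=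
      Finset.eq_univ_of_card _ (by simpa using le_antisymm hle h)
    funext i
    have hi : i ∈ nonExcluded (weigh P A B) := huniv ▸ Finset.mem_univ i
    exact (updateStatus_eq_excluded_or P hd A B i).resolve_left (Finset.mem_filter.mp hi).2

lemma nonExcluded_weigh_of_balanced {n : ℕ} (P : Position n)
    (hd : ∀ i, P.status i = CoinStatus.light ∨ P.status i = CoinStatus.heavy)
    {A B : Finset (Fin n)} (ho : outcome P A B = Outcome.balanced) :
    nonExcluded (weigh P A B) = (A ∪ B)ᶜ := by
  ext i
  rcases hd i with hi | hi <;>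
    simp [nonExcluded, weigh, updateStatus, ho, hi]

lemma nonExcluded_weigh_of_leftLighter {n : ℕ} (P : Position n)
    (hd : ∀ i, P.status i = CoinStatus.light ∨ P.status i = CoinStatus.heavy)
    {A B : Finset (Fin n)} (hAB : Disjoint A B) (ho : outcome P A B = Outcome.leftLighter) :
    nonExcluded (weigh P A B) =
      A ∩ statusSet P CoinStatus.light ∪ B ∩ statusSet P CoinStatus.heavy := by
  ext i
  have hi' : i ∈ A → i ∉ B := fun h => Finset.disjoint_left.mp hAB h
  rcases hd i with hi | hi <;> by_cases hA : i ∈ A <;> by_cases hB : i ∈ B <;>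
    simp_all [nonExcluded, weigh, updateStatus, statusSet, onLighterPan, onHeavierPan]

lemma nonExcluded_weigh_of_rightLighter {n : ℕ} (P : Position n)
    (hd : ∀ i, P.status i = CoinStatus.light ∨ P.status i = CoinStatus.heavy)
    {A B : Finset (Fin n)} (hAB : Disjoint A B) (ho : outcome P A B = Outcome.rightLighter) :
    nonExcluded (weigh P A B) =
      B ∩ statusSet P CoinStatus.light ∪ A ∩ statusSet P CoinStatus.heavy := by
  ext i
  have hi' : i ∈ A → i ∉ B := fun h => Finset.disjoint_left.mp hAB h
  rcases hd i with hi | hi <;> by_cases hA : i ∈ A <;> by_cases hB : i ∈ B <;>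
    simp_all [nonExcluded, weigh, updateStatus, statusSet, onLighterPan, onHeavierPan]

/-- Of `l` light-destined and `h` heavy-destined coins, one can place equally many coins on two
pans so that `x` light-destined coins lie on one pan and `y` heavy-destined coins on the other,
where `x ≥ a` and `y ≥ b`. -/
def Splits (l h a b x y : ℕ) : Prop :=
  a ≤ x ∧ b ≤ y ∧ x ≤ l ∧ y ≤ h ∧ 2 * x ≤ l + y ∧ 2 * y ≤ h + x

lemma Splits.symm {l h a b x y : ℕ} (H : Splits l h a b x y) : Splits h l b a y x := by
  unfold Splits at *
  omega

lemma splits_of_disjoint {α : Type*} [DecidableEq α] {A B L H : Finset α} (hAB : Disjoint A B)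
    (hcard : A.card = B.card) (hLH : Disjoint L H) (hA : A ⊆ L ∪ H) (hB : B ⊆ L ∪ H) {a b : ℕ}
    (ha : a ≤ (A ∩ L).card) (hb : b ≤ (B ∩ H).card) :
    Splits L.card H.card a b (A ∩ L).card (B ∩ H).card := by
  have key : ∀ S : Finset α, S ⊆ L ∪ H → S.card = (S ∩ L).card + (S ∩ H).card := by
    intro S hS
    rw [← Finset.card_union_of_disjoint
      (hLH.mono Finset.inter_subset_right Finset.inter_subset_right),
      ← Finset.inter_union_distrib_left, Finset.inter_eq_left.mpr hS]
  have bound : ∀ T : Finset α, (A ∩ T).card + (B ∩ T).card ≤ T.card := by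
    intro T
    rw [← Finset.card_union_of_disjoint
      (hAB.mono Finset.inter_subset_left Finset.inter_subset_left)]
    exact Finset.card_le_card
      (Finset.union_subset Finset.inter_subset_right Finset.inter_subset_right)
  have h1 := key A hA
  have h2 := key B hB
  have h3 := bound L
  have h4 := bound H
  unfold Splits
  omega

lemma exists_disjoint_subsets_card_eq {α : Type*} [DecidableEq α] {S T : Finset α} {x y : ℕ}
    (hT : T ⊆ S) (hTx : T.card ≤ x) (hxy : x + y ≤ S.card) :
    ∃ U V : Finset α, T ⊆ U ∧ U ⊆ S ∧ V ⊆ S ∧ Disjoint U V ∧ U.card = x ∧ V.card = y := by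
  obtain ⟨U, hTU, hUS, hU⟩ := Finset.exists_subsuperset_card_eq hT hTx (by omega : x ≤ S.card)
  obtain ⟨V, hVS, hV⟩ := Finset.exists_subset_card_eq
    (by rw [Finset.card_sdiff_of_subset hUS]; omega : y ≤ (S \ U).card)
  exact ⟨U, V, hTU, hUS, hVS.trans Finset.sdiff_subset,
    (Finset.disjoint_sdiff).mono_right hVS, hU, hV⟩

lemma Splits.exists_pans {α : Type*} [DecidableEq α] {L H S T : Finset α} {x y : ℕ}
    (hLH : Disjoint L H) (hS : S ⊆ L) (hT : T ⊆ H)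
    (hs : Splits L.card H.card S.card T.card x y) :
    ∃ A B : Finset α, Disjoint A B ∧ A.card = B.card ∧ S ⊆ A ∧ T ⊆ B ∧
      (A ∩ L).card = x ∧ (B ∩ H).card = y := by
  obtain ⟨hSx, hTy, hx, hy, hxy, hyx⟩ := hs
  obtain ⟨A₁, B₁, hSA, hA₁, hB₁, hd₁, cA₁, cB₁⟩ :=
    exists_disjoint_subsets_card_eq (y := max x y - y) hS hSx (by omega)
  obtain ⟨B₂, A₂, hTB, hB₂, hA₂, hd₂, cB₂, cA₂⟩ :=
    exists_disjoint_subsets_card_eq (y := max x y - x) hT hTy (by omega)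
  have hA : Disjoint A₁ A₂ := hLH.mono hA₁ hA₂
  have hB : Disjoint B₁ B₂ := hLH.mono hB₁ hB₂
  refine ⟨A₁ ∪ A₂, B₁ ∪ B₂, ?_, ?_, hSA.trans Finset.subset_union_left,
    hTB.trans Finset.subset_union_right, ?_, ?_⟩
  · simp only [Finset.disjoint_union_left, Finset.disjoint_union_right]
    exact ⟨⟨hd₁, (hLH.mono hB₁ hA₂).symm⟩, hLH.mono hA₁ hB₂, hd₂.symm⟩
  · rw [Finset.card_union_of_disjoint hA, Finset.card_union_of_disjoint hB]
    omega
  · rw [Finset.union_inter_distrib_right, Finset.inter_eq_left.mpr hA₁,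
      Finset.disjoint_iff_inter_eq_empty.mp (hLH.symm.mono_left hA₂), Finset.union_empty, cA₁]
  · rw [Finset.union_inter_distrib_right, Finset.inter_eq_left.mpr hB₂,
      Finset.disjoint_iff_inter_eq_empty.mp (hLH.mono_left hB₁), Finset.empty_union, cB₂]

/-- The numbers of non-excluded coins reachable by one legal weighing when all coins are destined;
the first alternative is a balanced weighing, the second an unbalanced one. -/
lemma exists_move_card_nonExcluded_iff {n l h : ℕ} (P : Position n)
    (hl : (statusSet P CoinStatus.light).card = l)
    (hh : (statusSet P CoinStatus.heavy).card = h)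
    (hd : ∀ i, P.status i = CoinStatus.light ∨ P.status i = CoinStatus.heavy)
    (hcf : P.status P.counterfeit = P.fakeType.destiny) (m : ℕ) :
    (∃ Q, Move P Q ∧ (nonExcluded Q).card = m) ↔
      (1 ≤ m ∧ m + 2 ≤ n ∧ m % 2 = n % 2) ∨
      ∃ x y, m = x + y ∧ m < n ∧
        Splits l h (statusSet P CoinStatus.light ∩ {P.counterfeit}).card
          (statusSet P CoinStatus.heavy ∩ {P.counterfeit}).card x y := by
  have hLH : Disjoint (statusSet P CoinStatus.light) (statusSet P CoinStatus.heavy) := by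
    rw [Finset.disjoint_left]
    intro i hi hi'
    simp_all [statusSet]
  have hcover : ∀ S : Finset (Fin n),
      S ⊆ statusSet P CoinStatus.light ∪ statusSet P CoinStatus.heavy := by
    intro S i _
    simpa [statusSet] using hd i
  constructor
  · rintro ⟨_, ⟨A, B, hAB, hcard, hne, rfl⟩, rfl⟩
    rw [updateStatus_ne_iff_card_lt P hd] at hne
    have sub : ∀ (S : Finset (Fin n)) (s : CoinStatus),
        (P.status P.counterfeit = s → P.counterfeit ∈ S) →
        (statusSet P s ∩ {P.counterfeit}).card ≤ (S ∩ statusSet P s).card := by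
      intro S s hS
      refine Finset.card_le_card fun i hi => ?_
      simp only [statusSet, Finset.mem_inter, Finset.mem_filter, Finset.mem_univ, true_and,
        Finset.mem_singleton] at hi ⊢
      obtain ⟨hi, rfl⟩ := hi
      exact ⟨hS hi, hi⟩
    cases ho : outcome P A B with
    | balanced =>
      left
      have hc : P.counterfeit ∉ A ∧ P.counterfeit ∉ B := by
        unfold outcome at ho
        cases hf : P.fakeType <;> rw [hf] at ho <;> split_ifs at ho <;> simp_all
      rw [nonExcluded_weigh_of_balanced P hd ho] at hne ⊢
      have hpos : 0 < ((A ∪ B)ᶜ).card :=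
        Finset.card_pos.mpr ⟨P.counterfeit, by simp [hc]⟩
      have hsum := Finset.card_add_card_compl (A ∪ B)
      rw [Finset.card_union_of_disjoint hAB, Fintype.card_fin] at hsum
      omega
    | leftLighter =>
      right
      have hc : (P.status P.counterfeit = CoinStatus.light → P.counterfeit ∈ A) ∧
          (P.status P.counterfeit = CoinStatus.heavy → P.counterfeit ∈ B) := by
        unfold outcome at ho
        cases hf : P.fakeType <;> rw [hf] at ho hcf <;> split_ifs at ho <;>
          simp_all [FakeType.destiny]
      have hs := splits_of_disjoint hAB hcard hLH (hcover A) (hcover B)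
        (sub A _ hc.1) (sub B _ hc.2)
      rw [hl, hh] at hs
      refine ⟨_, _, ?_, hne, hs⟩
      rw [nonExcluded_weigh_of_leftLighter P hd hAB ho, Finset.card_union_of_disjoint
        (hAB.mono Finset.inter_subset_left Finset.inter_subset_left)]
    | rightLighter =>
      right
      have hc : (P.status P.counterfeit = CoinStatus.light → P.counterfeit ∈ B) ∧
          (P.status P.counterfeit = CoinStatus.heavy → P.counterfeit ∈ A) := by
        unfold outcome at ho
        cases hf : P.fakeType <;> rw [hf] at ho hcf <;> split_ifs at ho <;>
          simp_all [FakeType.destiny]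
      have hs := splits_of_disjoint hAB.symm hcard.symm hLH (hcover B) (hcover A)
        (sub B _ hc.1) (sub A _ hc.2)
      rw [hl, hh] at hs
      refine ⟨_, _, ?_, hne, hs⟩
      rw [nonExcluded_weigh_of_rightLighter P hd hAB ho, Finset.card_union_of_disjoint
        (hAB.symm.mono Finset.inter_subset_left Finset.inter_subset_left)]
  · rintro (⟨h1, h2, h3⟩ | ⟨x, y, rfl, hlt, hs⟩)
    · obtain ⟨A, B, -, hA, hB, hAB, cA, cB⟩ := exists_disjoint_subsets_card_eq
        (S := Finset.univ \ {P.counterfeit}) (x := (n - m) / 2) (y := (n - m) / 2)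
        (Finset.empty_subset _) (by simp)
        (by rw [Finset.card_sdiff_of_subset (Finset.subset_univ _)]; simp; omega)
      have hcA : P.counterfeit ∉ A := fun h => by simpa using hA h
      have hcB : P.counterfeit ∉ B := fun h => by simpa using hB h
      have hm : (nonExcluded (weigh P A B)).card = m := by
        rw [nonExcluded_weigh_of_balanced P hd (by simp [outcome, hcA, hcB]), Finset.card_compl,
          Finset.card_union_of_disjoint hAB, Fintype.card_fin]
        omega
      exact ⟨_, ⟨A, B, hAB, cA.trans cB.symm,
        (updateStatus_ne_iff_card_lt P hd A B).mpr (by omega), rfl⟩, hm⟩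
    · rw [← hl, ← hh] at hs
      obtain ⟨A, B, hAB, hcard, hSA, hTB, hx, hy⟩ :=
        hs.exists_pans hLH Finset.inter_subset_left Finset.inter_subset_left
      have ho : outcome P A B = Outcome.leftLighter := by
        unfold outcome
        cases hf : P.fakeType <;> rw [hf] at hcf
        · have hc : P.counterfeit ∈ A := hSA (by simp [statusSet, hcf, FakeType.destiny])
          simp [hc]
        · have hc : P.counterfeit ∈ B := hTB (by simp [statusSet, hcf, FakeType.destiny])
          simp [hc, Finset.disjoint_right.mp hAB hc]
      have hm : (nonExcluded (weigh P A B)).card = x + y := by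
        rw [nonExcluded_weigh_of_leftLighter P hd hAB ho, Finset.card_union_of_disjoint
          (hAB.mono Finset.inter_subset_left Finset.inter_subset_left), hx, hy]
      exact ⟨_, ⟨A, B, hAB, hcard,
        (updateStatus_ne_iff_card_lt P hd A B).mpr (by omega), rfl⟩, hm⟩

lemma exists_splits {l h a b m : ℕ} (hlh : l ≤ h) (ha : a ≤ l) (hab : a + b = 1)
    (hm : 1 ≤ m) (hle : m ≤ (l + h) / 2 + l) (heq : l = h → m + 2 ≤ l + h)
    (hone : m = 1 → a = 1 → 2 ≤ l) : ∃ x y, m = x + y ∧ Splits l h a b x y := by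
  unfold Splits
  by_cases h1 : 2 * l ≤ m
  · exact ⟨l, m - l, by omega⟩
  · by_cases h2 : m = 1 ∧ a = 1
    · exact ⟨1, 0, by omega⟩
    · exact ⟨m / 2, (m + 1) / 2, by omega⟩

/-- The set of option sizes, with `a = 1`, `b = 0` if the counterfeit is light-destined and
`a = 0`, `b = 1` if it is heavy-destined. -/
lemma option_sizes_iff {n l h a b c m : ℕ} (hn : n = l + h) (hN : 2 ≤ l + h)
    (hab : a = 1 ∧ b = 0 ∧ c = l ∨ a = 0 ∧ b = 1 ∧ c = h) (hc : 1 ≤ c) :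
    ((1 ≤ m ∧ m + 2 ≤ n ∧ m % 2 = n % 2) ∨ ∃ x y, m = x + y ∧ m < n ∧ Splits l h a b x y) ↔
        (if l = h then 1 ≤ m ∧ m ≤ l + h - 2
         else
          ((1 ≤ m ∧ m ≤ l + h - 2 ∧ m % 2 = (l + h) % 2) ∨
            (1 ≤ m ∧ m ≤ (l + h) / 2 + min l h)) ∧
          ¬ (Even (l + h) ∧ c = 1 ∧ m = 1)) := by
  subst hn
  rw [Nat.even_iff]
  constructor
  · rintro (hbal | ⟨x, y, hm, hlt, hs⟩)
    · split_ifs <;> omega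
    · unfold Splits at hs
      split_ifs <;> omega
  · intro H
    by_cases hpar : 1 ≤ m ∧ m + 2 ≤ l + h ∧ m % 2 = (l + h) % 2
    · exact Or.inl hpar
    right
    rcases le_total l h with hle | hle
    · obtain ⟨x, y, hm, hs⟩ := exists_splits (m := m) (a := a) (b := b) hle
        (by omega) (by omega) (by split_ifs at H <;> omega)
        (by split_ifs at H <;> omega) (by split_ifs at H <;> omega)
        (by split_ifs at H <;> omega)
      exact ⟨x, y, hm, by split_ifs at H <;> omega, hs⟩
    · obtain ⟨x, y, hm, hs⟩ := exists_splits (m := m) (a := b) (b := a) hle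
        (by omega) (by omega) (by split_ifs at H <;> omega)
        (by split_ifs at H <;> omega) (by split_ifs at H <;> omega)
        (by split_ifs at H <;> omega)
      exact ⟨y, x, by omega, by split_ifs at H <;> omega, hs.symm⟩

/-- In the starting position of the destined-coins game
`D_{l,h}` (`l, h ≥ 0`, `N = l + h ≥ 2`, `(l,h) ≠ (1,1)`), with `c` the number
of coins sharing the counterfeit coin's destiny (counting the counterfeit
itself), the set of possible values of the number of non-excluded coins after
one legal weighing is exactly: `{1, …, N-2}` if `l = h`, and otherwise
`({m : 1 ≤ m ≤ N-2, m ≡ N (mod 2)} ∪ {m : 1 ≤ m ≤ ⌊N/2⌋ + min l h}) \ E`,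
where `E = {1}` if `N` is even and `c = 1`, and `E = ∅` otherwise. -/
theorem destined_first_move_set {n l h : ℕ} (P : Position n)
    (hN : 2 ≤ l + h) (hlh : ¬ (l = 1 ∧ h = 1))
    (hl : (statusSet P CoinStatus.light).card = l)
    (hh : (statusSet P CoinStatus.heavy).card = h)
    (hd : ∀ i, P.status i = CoinStatus.light ∨ P.status i = CoinStatus.heavy)
    (hcf : P.status P.counterfeit = P.fakeType.destiny) :
    ∀ m : ℕ,
      (∃ Q, Move P Q ∧ (nonExcluded Q).card = m) ↔
        (if l = h then 1 ≤ m ∧ m ≤ l + h - 2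
         else
          ((1 ≤ m ∧ m ≤ l + h - 2 ∧ m % 2 = (l + h) % 2) ∨
            (1 ≤ m ∧ m ≤ (l + h) / 2 + min l h)) ∧
          ¬ (Even (l + h) ∧ sameDestinyCount P = 1 ∧ m = 1)) := by
  intro m
  have hn : n = l + h := by
    rw [← hl, ← hh, ← Finset.card_union_of_disjoint]
    · rw [show statusSet P CoinStatus.light ∪ statusSet P CoinStatus.heavy = Finset.univ by
        ext i; simpa [statusSet] using hd i, Finset.card_univ, Fintype.card_fin]
    · rw [Finset.disjoint_left]
      intro i hi hi'
      simp_all [statusSet]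
  have hc : 1 ≤ sameDestinyCount P := Finset.card_pos.mpr ⟨P.counterfeit, by simp⟩
  rw [exists_move_card_nonExcluded_iff P hl hh hd hcf]
  refine option_sizes_iff hn hN ?_ hc
  cases hf : P.fakeType <;> rw [hf] at hcf <;>
    simp [sameDestinyCount, statusSet, hcf, FakeType.destiny, ← hl, ← hh]
end

section
/- In the starting position of the destined-coins game D_{l,h} with l, h ≥ 0, N = l + h ≥ 2 and (l,h) ≠ (1,1), let c be the number of coins sharing the counterfeit coin's destiny (counting the counterfeit itself), and let m* be the smallest positive integer that is NOT a possible value of the number of non-excluded coins after one legal weighing. Then: if N is even, l ≠ h and c = 1, then m* = 1; if l = h, then m* = N − 1; otherwise m* = min(N, s), where s is the least integer exceeding ⌊N/2⌋ + min(l,h) whose parity differs from that of N. -/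
/-- Every coin is destined, and the destiny of the counterfeit coin is truthful. -/
def Destined {n : ℕ} (P : Position n) : Prop :=
  (∀ i, P.status i = CoinStatus.light ∨ P.status i = CoinStatus.heavy) ∧
    P.status P.counterfeit = P.fakeType.destiny

/-- The coins sharing the destiny of the counterfeit coin. -/
def sameDestiny {n : ℕ} (P : Position n) : Finset (Fin n) :=
  Finset.univ.filter fun i => P.status i = P.status P.counterfeit

theorem mem_sameDestiny {n : ℕ} {P : Position n} {i : Fin n} :
    i ∈ sameDestiny P ↔ P.status i = P.status P.counterfeit := by
  simp [sameDestiny]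

theorem counterfeit_mem_sameDestiny {n : ℕ} (P : Position n) :
    P.counterfeit ∈ sameDestiny P := by
  simp [sameDestiny]

theorem weigh_comm {n : ℕ} (P : Position n) {A B : Finset (Fin n)} (hAB : Disjoint A B) :
    weigh P A B = weigh P B A := by
  have hd : ∀ i, i ∈ A → i ∉ B := fun i hA hB => Finset.disjoint_left.1 hAB hA hB
  have key : updateStatus P A B = updateStatus P B A := by
    funext i
    have h1 := hd i
    have h2 := hd P.counterfeit
    by_cases hA : P.counterfeit ∈ A <;> by_cases hB : P.counterfeit ∈ B <;>
      by_cases hiA : i ∈ A <;> by_cases hiB : i ∈ B <;> cases hf : P.fakeType <;>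
      simp_all [updateStatus, outcome]
  simp [weigh, key]

theorem nonExcluded_weigh_balanced {n : ℕ} {P : Position n} (hP : Destined P)
    {A B : Finset (Fin n)} (hA : P.counterfeit ∉ A) (hB : P.counterfeit ∉ B) :
    nonExcluded (weigh P A B) = (A ∪ B)ᶜ := by
  ext i
  have := hP.1 i
  by_cases hiA : i ∈ A <;> by_cases hiB : i ∈ B <;> rcases this with h | h <;>
    simp [nonExcluded, weigh, updateStatus, outcome, hA, hB, hiA, hiB, h]

theorem nonExcluded_weigh_unbalanced {n : ℕ} {P : Position n} (hP : Destined P)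
    {A B : Finset (Fin n)} (hAB : Disjoint A B) (hA : P.counterfeit ∈ A) :
    nonExcluded (weigh P A B) = A ∩ sameDestiny P ∪ B \ sameDestiny P := by
  ext i
  have hd : i ∈ A → i ∉ B := fun hA hB => Finset.disjoint_left.1 hAB hA hB
  have h2 := hP.2
  by_cases hiA : i ∈ A <;> by_cases hiB : i ∈ B <;> rcases hP.1 i with h | h <;>
    cases hf : P.fakeType <;>
    simp_all [nonExcluded, weigh, updateStatus, outcome, sameDestiny, onLighterPan,
      onHeavierPan, FakeType.destiny]

theorem updateStatus_eq_or_excluded {n : ℕ} {P : Position n} (hP : Destined P)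
    (A B : Finset (Fin n)) (i : Fin n) :
    updateStatus P A B i = P.status i ∨ updateStatus P A B i = CoinStatus.excluded := by
  by_cases hiA : i ∈ A <;> by_cases hiB : i ∈ B <;> rcases hP.1 i with h | h <;>
    cases ho : outcome P A B <;>
    simp [updateStatus, ho, hiA, hiB, h, onLighterPan, onHeavierPan]

theorem updateStatus_ne_iff {n : ℕ} {P : Position n} (hP : Destined P)
    (A B : Finset (Fin n)) :
    updateStatus P A B ≠ P.status ↔ (nonExcluded (weigh P A B)).card < n := by
  have hlt : (nonExcluded (weigh P A B)).card < n ↔ nonExcluded (weigh P A B) ≠ Finset.univ := by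
    rw [Ne, ← Finset.card_eq_iff_eq_univ, Fintype.card_fin]
    have := Finset.card_le_univ (nonExcluded (weigh P A B))
    rw [Fintype.card_fin] at this
    omega
  rw [hlt, not_iff_not]
  constructor
  · intro h
    ext i
    have := hP.1 i
    rcases this with h' | h' <;> simp [nonExcluded, weigh, h, h']
  · intro h
    funext i
    have hi : i ∈ nonExcluded (weigh P A B) := h ▸ Finset.mem_univ i
    have hne : updateStatus P A B i ≠ CoinStatus.excluded := by
      exact (Finset.mem_filter.1 hi).2
    exact (updateStatus_eq_or_excluded hP A B i).resolve_right hne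

/-- The numbers of coins that can remain after one legal weighing, when `c` coins share the
destiny of the counterfeit coin and `e` coins do not. After an unbalanced weighing with `k`
coins on each pan, `p` counts the remaining coins of the first kind and `q` those of the
second kind. -/
def Reachable (c e m : ℕ) : Prop :=
  m < c + e ∧ ((0 < m ∧ m % 2 = (c + e) % 2) ∨
    ∃ k p q, 0 < p ∧ p ≤ k ∧ q ≤ k ∧ p + (k - q) ≤ c ∧ q + (k - p) ≤ e ∧ m = p + q)

theorem card_sameDestiny_add {n : ℕ} (P : Position n) :
    (sameDestiny P).card + (sameDestiny P)ᶜ.card = n := by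
  rw [Finset.card_add_card_compl, Fintype.card_fin]

theorem reachable_of_move {n : ℕ} {P Q : Position n} (hP : Destined P) (hM : Move P Q) :
    Reachable (sameDestiny P).card (sameDestiny P)ᶜ.card (nonExcluded Q).card := by
  obtain ⟨A, B, hAB, hcard, hne, rfl⟩ := hM
  rw [updateStatus_ne_iff hP] at hne
  refine ⟨by rwa [card_sameDestiny_add], ?_⟩
  rw [card_sameDestiny_add]
  have main : ∀ A B : Finset (Fin n), Disjoint A B → A.card = B.card → P.counterfeit ∈ A →
      ∃ k p q, 0 < p ∧ p ≤ k ∧ q ≤ k ∧ p + (k - q) ≤ (sameDestiny P).card ∧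
        q + (k - p) ≤ (sameDestiny P)ᶜ.card ∧ (nonExcluded (weigh P A B)).card = p + q := by
    intro A B hAB hcard hA
    have hA' := Finset.card_inter_add_card_sdiff A (sameDestiny P)
    have hB' := Finset.card_inter_add_card_sdiff B (sameDestiny P)
    have hS : (A ∩ sameDestiny P ∪ B ∩ sameDestiny P).card ≤ (sameDestiny P).card :=
      Finset.card_le_card (by grind)
    have hT : (A \ sameDestiny P ∪ B \ sameDestiny P).card ≤ (sameDestiny P)ᶜ.card :=
      Finset.card_le_card (by intro i hi; rw [Finset.mem_compl]; grind)
    rw [Finset.card_union_of_disjoint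
      (hAB.mono Finset.inter_subset_left Finset.inter_subset_left)] at hS
    rw [Finset.card_union_of_disjoint
      (hAB.mono Finset.sdiff_subset Finset.sdiff_subset)] at hT
    refine ⟨A.card, (A ∩ sameDestiny P).card, (B \ sameDestiny P).card,
      Finset.card_pos.2 ⟨_, Finset.mem_inter.2 ⟨hA, counterfeit_mem_sameDestiny P⟩⟩,
      by omega, by omega, by omega, by omega, ?_⟩
    rw [nonExcluded_weigh_unbalanced hP hAB hA, Finset.card_union_of_disjoint
      (hAB.mono Finset.inter_subset_left Finset.sdiff_subset)]
  by_cases hA : P.counterfeit ∈ A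
  · exact Or.inr (main A B hAB hcard hA)
  by_cases hB : P.counterfeit ∈ B
  · rw [weigh_comm P hAB]
    exact Or.inr (main B A hAB.symm hcard.symm hB)
  · left
    have hmem : P.counterfeit ∈ (A ∪ B)ᶜ := by simp [hA, hB]
    have hsum := Finset.card_add_card_compl (A ∪ B)
    rw [Finset.card_union_of_disjoint hAB, Fintype.card_fin] at hsum
    rw [nonExcluded_weigh_balanced hP hA hB]
    exact ⟨Finset.card_pos.2 ⟨_, hmem⟩, by omega⟩

theorem exists_move_of_reachable {n m : ℕ} {P : Position n} (hP : Destined P)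
    (hm : Reachable (sameDestiny P).card (sameDestiny P)ᶜ.card m) :
    ∃ Q, Move P Q ∧ (nonExcluded Q).card = m := by
  rw [Reachable, card_sameDestiny_add] at hm
  obtain ⟨hlt, ⟨hpos, hpar⟩ | ⟨k, p, q, hp, hpk, hqk, hS, hT, rfl⟩⟩ := hm
  · obtain ⟨k, hk⟩ : ∃ k, m + (k + k) = n := ⟨(n - m) / 2, by omega⟩
    have hU : ({P.counterfeit}ᶜ : Finset (Fin n)).card = n - 1 := by
      rw [Finset.card_compl, Fintype.card_fin, Finset.card_singleton]
    obtain ⟨A, hAU, hA⟩ := Finset.exists_subset_card_eq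
      (s := ({P.counterfeit}ᶜ : Finset (Fin n))) (n := k) (by omega)
    obtain ⟨B, hBU, hB⟩ := Finset.exists_subset_card_eq
      (s := ({P.counterfeit}ᶜ : Finset (Fin n)) \ A) (n := k)
      (by rw [Finset.card_sdiff_of_subset hAU]; omega)
    have hAB : Disjoint A B := Finset.disjoint_left.2 fun i hi hi' => by
      simpa [hi] using hBU hi'
    have hcA : P.counterfeit ∉ A := fun h => by simpa using hAU h
    have hcB : P.counterfeit ∉ B := fun h => by simpa using hBU h
    have hcard : (nonExcluded (weigh P A B)).card = m := by
      rw [nonExcluded_weigh_balanced hP hcA hcB, Finset.card_compl, Fintype.card_fin,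
        Finset.card_union_of_disjoint hAB]
      omega
    exact ⟨_, ⟨A, B, hAB, by omega, (updateStatus_ne_iff hP A B).2 (by omega), rfl⟩, hcard⟩
  · obtain ⟨A₁, hcA, hA₁S, hA₁⟩ := Finset.exists_subsuperset_card_eq
      (s := {P.counterfeit}) (t := sameDestiny P) (n := p)
      (by simpa using counterfeit_mem_sameDestiny P) (by simpa using Nat.succ_le_of_lt hp) (by omega)
    obtain ⟨B₁, hB₁S, hB₁⟩ := Finset.exists_subset_card_eq
      (s := sameDestiny P \ A₁) (n := k - q)
      (by rw [Finset.card_sdiff_of_subset hA₁S]; omega)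
    obtain ⟨B₂, hB₂T, hB₂⟩ := Finset.exists_subset_card_eq
      (s := (sameDestiny P)ᶜ) (n := q) (by omega)
    obtain ⟨A₂, hA₂T, hA₂⟩ := Finset.exists_subset_card_eq
      (s := (sameDestiny P)ᶜ \ B₂) (n := k - p)
      (by rw [Finset.card_sdiff_of_subset hB₂T]; omega)
    have h1 : ∀ i ∈ A₁, i ∈ sameDestiny P := fun i hi => hA₁S hi
    have h2 : ∀ i ∈ B₁, i ∈ sameDestiny P ∧ i ∉ A₁ := fun i hi => by simpa using hB₁S hi
    have h3 : ∀ i ∈ B₂, i ∉ sameDestiny P := fun i hi => by simpa using hB₂T hi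
    have h4 : ∀ i ∈ A₂, i ∉ sameDestiny P ∧ i ∉ B₂ := fun i hi => by simpa using hA₂T hi
    have hAB : Disjoint (A₁ ∪ A₂) (B₁ ∪ B₂) := Finset.disjoint_left.2 (by grind)
    have hA : (A₁ ∪ A₂).card = k := by
      rw [Finset.card_union_of_disjoint (Finset.disjoint_left.2 (by grind))]
      omega
    have hB : (B₁ ∪ B₂).card = k := by
      rw [Finset.card_union_of_disjoint (Finset.disjoint_left.2 (by grind))]
      omega
    have hcard : (nonExcluded (weigh P (A₁ ∪ A₂) (B₁ ∪ B₂))).card = p + q := by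
      rw [nonExcluded_weigh_unbalanced hP hAB
        (Finset.mem_union_left _ (hcA (Finset.mem_singleton_self _)))]
      have : (A₁ ∪ A₂) ∩ sameDestiny P ∪ (B₁ ∪ B₂) \ sameDestiny P = A₁ ∪ B₂ := by
        ext i
        grind
      rw [this, Finset.card_union_of_disjoint (Finset.disjoint_left.2 (by grind)), hA₁, hB₂]
    exact ⟨_, ⟨_, _, hAB, by omega, (updateStatus_ne_iff hP _ _).2 (by omega), rfl⟩, hcard⟩

theorem isLeast_not_reachable {c e : ℕ} (hc : 0 < c) (hN : 2 ≤ c + e) :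
    IsLeast {m : ℕ | 0 < m ∧ ¬ Reachable c e m}
      (if Even (c + e) ∧ c ≠ e ∧ c = 1 then 1
       else if c = e then c + e - 1
       else
        min (c + e)
          (if ((c + e) / 2 + min c e + 1) % 2 ≠ (c + e) % 2
           then (c + e) / 2 + min c e + 1
           else (c + e) / 2 + min c e + 2)) := by
  simp only [Nat.even_iff]
  constructor
  · refine ⟨by split_ifs <;> omega, ?_⟩
    rintro ⟨hlt, ⟨hpos, hpar⟩ | ⟨k, p, q, hp, hpk, hqk, hS, hT, hm⟩⟩
    · split_ifs at * <;> omega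
    · split_ifs at * <;> omega
  · rintro m ⟨hm, hr⟩
    by_contra hlt
    apply hr
    have hlt' : m < c + e := by split_ifs at hlt <;> omega
    refine ⟨hlt', ?_⟩
    by_cases hpar : m % 2 = (c + e) % 2
    · exact Or.inl ⟨hm, hpar⟩
    right
    by_cases h1 : m = 1
    · exact ⟨1, 1, 0, by split_ifs at hlt <;> omega⟩
    have hbound : 2 * m ≤ c + e + 2 * min c e := by
      rw [not_le] at hlt
      split_ifs at hlt
      · omega
      · omega
      all_goals
        replace hlt := hlt.trans_le (min_le_right _ _)
        generalize min c e = d at *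
        omega
    have hdiag : c = e → m < c + e - 1 := by
      split_ifs at hlt <;> omega
    clear hlt
    rcases le_or_gt e c with h | h
    · rw [min_eq_right h] at hbound
      rcases le_or_gt (2 * e) m with h2 | h2
      · exact ⟨m - e, m - e, e, by omega⟩
      · exact ⟨m - m / 2, m - m / 2, m / 2, by omega⟩
    · rw [min_eq_left h.le] at hbound
      rcases le_or_gt (2 * c) m with h2 | h2
      · exact ⟨m - c, c, m - c, by omega⟩
      · exact ⟨m - m / 2, m / 2, m - m / 2, by omega⟩

/-- In the starting position of the destined-coins game
`D_{l,h}` (`l, h ≥ 0`, `N = l + h ≥ 2`, `(l,h) ≠ (1,1)`), with `c` the number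
of coins sharing the counterfeit coin's destiny, the smallest positive integer
`m*` that is not a possible value of the number of non-excluded coins after one
legal weighing is: `1` if `N` is even, `l ≠ h` and `c = 1`; `N - 1` if `l = h`;
and otherwise `min N s`, where `s` is the least integer exceeding
`⌊N/2⌋ + min l h` whose parity differs from that of `N`. -/
theorem destined_least_unreachable {n l h : ℕ} (P : Position n)
    (hN : 2 ≤ l + h) (hlh : ¬ (l = 1 ∧ h = 1))
    (hl : (statusSet P CoinStatus.light).card = l)
    (hh : (statusSet P CoinStatus.heavy).card = h)
    (hd : ∀ i, P.status i = CoinStatus.light ∨ P.status i = CoinStatus.heavy)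
    (hcf : P.status P.counterfeit = P.fakeType.destiny) :
    IsLeast {m : ℕ | 0 < m ∧ ¬ ∃ Q, Move P Q ∧ (nonExcluded Q).card = m}
      (if Even (l + h) ∧ l ≠ h ∧ sameDestinyCount P = 1 then 1
       else if l = h then l + h - 1
       else
        min (l + h)
          (if ((l + h) / 2 + min l h + 1) % 2 ≠ (l + h) % 2
           then (l + h) / 2 + min l h + 1
           else (l + h) / 2 + min l h + 2)) := by
  have hP : Destined P := ⟨hd, hcf⟩
  have hset : {m : ℕ | 0 < m ∧ ¬ ∃ Q, Move P Q ∧ (nonExcluded Q).card = m} =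
      {m : ℕ | 0 < m ∧ ¬ Reachable (sameDestiny P).card (sameDestiny P)ᶜ.card m} := by
    ext m
    refine and_congr_right fun _ => not_congr ⟨?_, exists_move_of_reachable hP⟩
    rintro ⟨Q, hQ, rfl⟩
    exact reachable_of_move hP hQ
  have hcompl : (statusSet P CoinStatus.light)ᶜ = statusSet P CoinStatus.heavy := by
    ext i
    rcases hd i with h | h <;> simp [statusSet, h]
  have hsame : sameDestinyCount P = (sameDestiny P).card := rfl
  rw [hset, hsame]
  have hpos : 0 < (sameDestiny P).card :=
    Finset.card_pos.2 ⟨_, counterfeit_mem_sameDestiny P⟩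
  rcases hd P.counterfeit with hs | hs
  · have hS : sameDestiny P = statusSet P CoinStatus.light := by simp [sameDestiny, statusSet, hs]
    rw [hS, hl] at hpos
    rw [hS, hcompl, hl, hh]
    exact isLeast_not_reachable hpos hN
  · have hS : sameDestiny P = statusSet P CoinStatus.heavy := by simp [sameDestiny, statusSet, hs]
    rw [hS, hh] at hpos
    rw [hS, ← hcompl, compl_compl, hcompl, hl, hh]
    have := isLeast_not_reachable (e := l) hpos (by omega)
    simpa only [add_comm h l, min_comm h l, ne_eq, eq_comm (a := h) (b := l)] using this
end

section
/- For N ≥ 3, the Grundy value of the normal-play destined-coins game in which all N coins are destined to be lighter is: G(D_{N,0}) = 2k if N = 4k, G(D_{N,0}) = 2k+1 if N = 4k+1, G(D_{N,0}) = 2k+2 if N = 4k+2, and G(D_{N,0}) = 2k+1 if N = 4k+3. -/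
/-- Positions in which every coin is light-destined or excluded, and the counterfeit coin is
light-destined and truly light. -/
structure LightPosition {n : ℕ} (P : Position n) : Prop where
  fakeType : P.fakeType = FakeType.light
  status : ∀ i, P.status i = CoinStatus.light ∨ P.status i = CoinStatus.excluded
  counterfeit : P.status P.counterfeit = CoinStatus.light

theorem mem_nonExcluded {n : ℕ} {P : Position n} {i : Fin n} :
    i ∈ nonExcluded P ↔ P.status i ≠ CoinStatus.excluded := by
  simp [nonExcluded]

theorem mex_eq_of_forall_lt {s : Set ℕ} {k : ℕ} (hk : k ∉ s) (hlt : ∀ j < k, j ∈ s) :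
    mex s = k := by
  refine le_antisymm (Nat.sInf_le hk) (le_csInf ⟨k, hk⟩ fun j hj => ?_)
  by_contra! h
  exact hj (hlt j h)

theorem exists_disjoint_union_eq_of_even_card {α : Type*} [DecidableEq α] {D : Finset α}
    (hD : Even D.card) :
    ∃ A B : Finset α, Disjoint A B ∧ A.card = B.card ∧ A ∪ B = D := by
  obtain ⟨r, hr⟩ := hD
  obtain ⟨A, hA, hc⟩ := Finset.exists_subset_card_eq (s := D) (n := r) (by omega)
  refine ⟨A, D \ A, Finset.disjoint_sdiff, ?_, Finset.union_sdiff_of_subset hA⟩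
  rw [Finset.card_sdiff_of_subset hA]
  omega

namespace LightPosition

variable {n : ℕ} {P : Position n}

theorem counterfeit_mem (h : LightPosition P) : P.counterfeit ∈ nonExcluded P := by
  simp [mem_nonExcluded, h.counterfeit]

theorem card_pos (h : LightPosition P) : 0 < (nonExcluded P).card :=
  Finset.card_pos.2 ⟨_, h.counterfeit_mem⟩

theorem info_eq (h : LightPosition P) : info P = (nonExcluded P).card := by
  rw [info, nonExcluded, Finset.card_filter]
  refine Finset.sum_congr rfl fun i _ => ?_
  rcases h.status i with hi | hi <;> simp [hi, statusWeight]

theorem weigh (h : LightPosition P) (A B : Finset (Fin n)) :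
    LightPosition (weigh P A B) := by
  have hc := h.counterfeit
  refine ⟨h.fakeType, fun i => ?_, ?_⟩
  · rcases h.status i with hi | hi <;>
      simp only [_root_.weigh, updateStatus, hi] <;>
      split <;> split_ifs <;> simp [onLighterPan, onHeavierPan]
  · by_cases hA : P.counterfeit ∈ A
    · simp [_root_.weigh, updateStatus, outcome, h.fakeType, hA, hc, onLighterPan]
    · by_cases hB : P.counterfeit ∈ B <;>
        simp [_root_.weigh, updateStatus, outcome, h.fakeType, hA, hB, hc, onLighterPan]

theorem nonExcluded_weigh (h : LightPosition P) {A B : Finset (Fin n)} :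
    nonExcluded (_root_.weigh P A B) =
      if P.counterfeit ∈ A then nonExcluded P ∩ A
      else if P.counterfeit ∈ B then nonExcluded P ∩ B
      else nonExcluded P \ (A ∪ B) := by
  ext i
  by_cases hA : P.counterfeit ∈ A
  · rcases h.status i with hi | hi <;> by_cases hiA : i ∈ A <;> by_cases hiB : i ∈ B <;>
      simp [mem_nonExcluded, _root_.weigh, updateStatus, outcome, h.fakeType, hA, hi, hiA, hiB,
        onLighterPan, onHeavierPan]
  · by_cases hB : P.counterfeit ∈ B <;>
      rcases h.status i with hi | hi <;> by_cases hiA : i ∈ A <;> by_cases hiB : i ∈ B <;>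
      simp [mem_nonExcluded, _root_.weigh, updateStatus, outcome, h.fakeType, hA, hB, hi, hiA,
        hiB, onLighterPan, onHeavierPan]

theorem status_eq_of_nonExcluded_eq {Q : Position n} (hP : LightPosition P) (hQ : LightPosition Q)
    (he : nonExcluded P = nonExcluded Q) : P.status = Q.status := by
  funext i
  have hi : i ∈ nonExcluded P ↔ i ∈ nonExcluded Q := by rw [he]
  rw [mem_nonExcluded, mem_nonExcluded] at hi
  rcases hP.status i with h1 | h1 <;> rcases hQ.status i with h2 | h2 <;> simp_all

theorem nonExcluded_ssubset_of_move (h : LightPosition P) {Q : Position n} (hm : Move P Q) :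
    LightPosition Q ∧ nonExcluded Q ⊂ nonExcluded P := by
  obtain ⟨A, B, -, -, hne, rfl⟩ := hm
  refine ⟨h.weigh A B, Finset.ssubset_iff_subset_ne.2 ⟨?_, fun he => ?_⟩⟩
  · rw [h.nonExcluded_weigh]
    split_ifs
    exacts [Finset.inter_subset_left, Finset.inter_subset_left, Finset.sdiff_subset]
  · exact hne ((h.weigh A B).status_eq_of_nonExcluded_eq h he)

theorem gMove_weigh (h : LightPosition P) {A B : Finset (Fin n)} (hAB : Disjoint A B)
    (hcard : A.card = B.card)
    (hlt : (nonExcluded (_root_.weigh P A B)).card < (nonExcluded P).card) :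
    GMove Found P (_root_.weigh P A B) := by
  have hpos := (h.weigh A B).card_pos
  refine ⟨fun hf => ?_, A, B, hAB, hcard, fun he => ?_, rfl⟩
  · rw [Found] at hf
    omega
  · have : nonExcluded (_root_.weigh P A B) = nonExcluded P := by
      ext i
      rw [mem_nonExcluded, mem_nonExcluded, ← he]
      rfl
    exact hlt.ne (congrArg Finset.card this)

/-- Excluding a prescribed set of coins by a balanced weighing. -/
theorem exists_gMove_sdiff (h : LightPosition P) {D : Finset (Fin n)} (hD : Even D.card)
    (hc : P.counterfeit ∉ D) (hne : (nonExcluded P \ D).card < (nonExcluded P).card) :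
    ∃ Q, GMove Found P Q ∧ LightPosition Q ∧ nonExcluded Q = nonExcluded P \ D := by
  obtain ⟨A, B, hAB, hcard, rfl⟩ := exists_disjoint_union_eq_of_even_card hD
  have hQ : nonExcluded (_root_.weigh P A B) = nonExcluded P \ (A ∪ B) := by
    rw [Finset.mem_union, not_or] at hc
    rw [h.nonExcluded_weigh, if_neg hc.1, if_neg hc.2]
  exact ⟨_, h.gMove_weigh hAB hcard (hQ ▸ hne), h.weigh A B, hQ⟩

/-- Once some coin is excluded, a balanced weighing can leave any smaller positive number of
light-destined coins. -/
theorem exists_gMove_card_eq (h : LightPosition P) (hex : (nonExcluded P).card < n) {m : ℕ}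
    (hm : 0 < m) (hlt : m < (nonExcluded P).card) :
    ∃ Q, GMove Found P Q ∧ LightPosition Q ∧ (nonExcluded Q).card = m := by
  obtain ⟨M, hM, hMc⟩ := Finset.exists_subset_card_eq
    (s := (nonExcluded P).erase P.counterfeit) (n := (nonExcluded P).card - m)
    (by rw [Finset.card_erase_of_mem h.counterfeit_mem]; omega)
  have hML : M ⊆ nonExcluded P := hM.trans (Finset.erase_subset _ _)
  have hcM : P.counterfeit ∉ M := fun hc => Finset.notMem_erase _ _ (hM hc)
  have hcard : (nonExcluded P \ M).card = m := by
    rw [Finset.card_sdiff_of_subset hML]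
    omega
  obtain ⟨D, hD, hcD, hDM⟩ : ∃ D : Finset (Fin n), Even D.card ∧ P.counterfeit ∉ D ∧
      nonExcluded P \ D = nonExcluded P \ M := by
    rcases Nat.even_or_odd M.card with hev | hodd
    · exact ⟨M, hev, hcM, rfl⟩
    · obtain ⟨x, hx⟩ : ∃ x, x ∉ nonExcluded P := by
        by_contra! hall
        rw [Finset.eq_univ_iff_forall.2 hall, Finset.card_univ, Fintype.card_fin] at hex
        exact lt_irrefl _ hex
      refine ⟨insert x M, ?_, ?_, Finset.sdiff_insert_of_notMem hx M⟩
      · rw [Finset.card_insert_of_notMem fun hxM => hx (hML hxM)]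
        exact hodd.add_one
      · rw [Finset.mem_insert, not_or]
        exact ⟨fun he => hx (he ▸ h.counterfeit_mem), hcM⟩
  obtain ⟨Q, hPQ, hQ, hQD⟩ := h.exists_gMove_sdiff hD hcD (by rw [hDM, hcard]; exact hlt)
  exact ⟨Q, hPQ, hQ, by rw [hQD, hDM, hcard]⟩

/-- With at least one excluded coin, the Grundy value is one less than the number of
light-destined coins. -/
theorem grundyAux_of_card_lt {k : ℕ} (h : LightPosition P) (hex : (nonExcluded P).card < n)
    (hk : (nonExcluded P).card ≤ k + 1) :
    grundyAux (GMove Found) k P = (nonExcluded P).card - 1 := by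
  induction k generalizing P with
  | zero => rw [grundyAux]; omega
  | succ k ih =>
    rw [grundyAux]
    refine mex_eq_of_forall_lt ?_ fun j hj => ?_
    · rintro ⟨Q, hPQ, hg⟩
      obtain ⟨hQ, hss⟩ := h.nonExcluded_ssubset_of_move hPQ.2
      have hlt := Finset.card_lt_card hss
      have hpos := hQ.card_pos
      rw [ih hQ (by omega) (by omega)] at hg
      omega
    · obtain ⟨Q, hPQ, hQ, hQc⟩ := h.exists_gMove_card_eq hex (m := j + 1) (by omega) (by omega)
      exact ⟨Q, hPQ, by rw [ih hQ (by omega) (by omega)]; omega⟩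

/-- The numbers of light-destined coins that one weighing can leave when none is excluded. -/
theorem exists_gMove_card_eq_iff (h : LightPosition P) (hall : nonExcluded P = Finset.univ)
    {m : ℕ} :
    (∃ Q, GMove Found P Q ∧ (nonExcluded Q).card = m) ↔
      0 < m ∧ (2 * m ≤ n ∨ ∃ a, 0 < a ∧ m + 2 * a = n) := by
  have hcardP : (nonExcluded P).card = n := by rw [hall, Finset.card_univ, Fintype.card_fin]
  constructor
  · rintro ⟨Q, ⟨-, hPQ⟩, rfl⟩
    obtain ⟨hQ, hss⟩ := h.nonExcluded_ssubset_of_move hPQ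
    have hlt := Finset.card_lt_card hss
    refine ⟨hQ.card_pos, ?_⟩
    obtain ⟨A, B, hAB, hcard, -, rfl⟩ := hPQ
    have hu : (A ∪ B).card ≤ n := (Finset.card_le_univ _).trans_eq (Fintype.card_fin n)
    have hunion := Finset.card_union_of_disjoint hAB
    rw [h.nonExcluded_weigh, hall] at hlt ⊢
    split_ifs at hlt ⊢
    · rw [Finset.univ_inter]
      omega
    · rw [Finset.univ_inter]
      omega
    · rw [Finset.card_sdiff_of_subset (Finset.subset_univ _), Finset.card_univ,
        Fintype.card_fin] at hlt ⊢
      exact Or.inr ⟨A.card, by omega, by omega⟩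
  · rintro ⟨hm, h2 | ⟨a, ha, hn⟩⟩
    · obtain ⟨A, hcA, -, hA⟩ := Finset.exists_subsuperset_card_eq
        (Finset.subset_univ {P.counterfeit}) (n := m) (by rwa [Finset.card_singleton])
        (by rw [Finset.card_univ, Fintype.card_fin]; omega)
      obtain ⟨B, hB, hBc⟩ := Finset.exists_subset_card_eq (s := Aᶜ) (n := m)
        (by rw [Finset.card_compl, Fintype.card_fin]; omega)
      have hAB : Disjoint A B := (disjoint_compl_right).mono_right hB
      have hQ : nonExcluded (_root_.weigh P A B) = A := by
        rw [h.nonExcluded_weigh, if_pos (Finset.singleton_subset_iff.1 hcA), hall,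
          Finset.univ_inter]
      exact ⟨_, h.gMove_weigh hAB (hA.trans hBc.symm) (by rw [hQ]; omega), by rw [hQ, hA]⟩
    · obtain ⟨D, hD, hDc⟩ := Finset.exists_subset_card_eq
        (s := Finset.univ.erase P.counterfeit) (n := 2 * a)
        (by
          rw [Finset.card_erase_of_mem (Finset.mem_univ _), Finset.card_univ, Fintype.card_fin]
          omega)
      have hcard : (nonExcluded P \ D).card = m := by
        rw [hall, Finset.card_sdiff_of_subset (Finset.subset_univ _), Finset.card_univ,
          Fintype.card_fin]
        omega
      obtain ⟨Q, hPQ, -, hQ⟩ := h.exists_gMove_sdiff (D := D) (by simp [hDc])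
        (fun hc => Finset.notMem_erase _ _ (hD hc)) (by omega)
      exact ⟨Q, hPQ, by rw [hQ, hcard]⟩

theorem grundy_eq_mex (h : LightPosition P) (hall : nonExcluded P = Finset.univ) :
    grundy (GMove Found) P =
      mex {g | 2 * (g + 1) ≤ n ∨ ∃ a, 0 < a ∧ g + 1 + 2 * a = n} := by
  have hcardP : (nonExcluded P).card = n := by rw [hall, Finset.card_univ, Fintype.card_fin]
  have hpos := h.card_pos
  obtain ⟨k, hk⟩ : ∃ k, n = k + 1 := ⟨n - 1, by omega⟩
  have hval : ∀ Q, GMove Found P Q →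
      grundyAux (GMove Found) k Q + 1 = (nonExcluded Q).card := fun Q hPQ => by
    obtain ⟨hQ, hss⟩ := h.nonExcluded_ssubset_of_move hPQ.2
    have hlt := Finset.card_lt_card hss
    have hQpos := hQ.card_pos
    rw [hQ.grundyAux_of_card_lt (by omega) (by omega)]
    omega
  have hinfo : info P = k + 1 := by rw [h.info_eq, hcardP, hk]
  rw [grundy, hinfo, grundyAux]
  congr 1
  ext g
  have hiff := h.exists_gMove_card_eq_iff hall (m := g + 1)
  rw [and_iff_right g.succ_pos] at hiff
  rw [Set.mem_ofPred_eq, Set.mem_ofPred_eq, ← hiff]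
  refine exists_congr fun Q => and_congr_right fun hPQ => ?_
  have := hval Q hPQ
  omega

end LightPosition

/-- For `N ≥ 3`, the Grundy value of the normal-play
destined-coins game in which all `N` coins are destined to be lighter is
`G(D_{N,0}) = 2k` if `N = 4k`, `2k+1` if `N = 4k+1`, `2k+2` if `N = 4k+2`,
and `2k+1` if `N = 4k+3`. -/
theorem grundy_destined_all_light {n : ℕ} (P : Position n) (hN : 3 ≤ n)
    (hall : ∀ i, P.status i = CoinStatus.light)
    (hft : P.fakeType = FakeType.light) :
    ∀ k : ℕ,
      (n = 4 * k → grundy (GMove Found) P = 2 * k) ∧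
      (n = 4 * k + 1 → grundy (GMove Found) P = 2 * k + 1) ∧
      (n = 4 * k + 2 → grundy (GMove Found) P = 2 * k + 2) ∧
      (n = 4 * k + 3 → grundy (GMove Found) P = 2 * k + 1) := by
  have hP : LightPosition P := ⟨hft, fun i => Or.inl (hall i), hall _⟩
  have huniv : nonExcluded P = Finset.univ :=
    Finset.eq_univ_iff_forall.2 fun i => by simp [mem_nonExcluded, hall i]
  intro k
  rw [hP.grundy_eq_mex huniv]
  refine ⟨?_, ?_, ?_, ?_⟩ <;> rintro rfl <;> refine mex_eq_of_forall_lt ?_ fun j hj => ?_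
  · rintro (h | ⟨a, ha, h⟩) <;> omega
  · exact Or.inl (by omega)
  · rintro (h | ⟨a, ha, h⟩) <;> omega
  · rcases Nat.lt_or_ge j (2 * k) with h | h
    · exact Or.inl (by omega)
    · exact Or.inr ⟨k, by omega, by omega⟩
  · rintro (h | ⟨a, ha, h⟩) <;> omega
  · rcases Nat.lt_or_ge j (2 * k + 1) with h | h
    · exact Or.inl (by omega)
    · exact Or.inr ⟨k, by omega, by omega⟩
  · rintro (h | ⟨a, ha, h⟩) <;> omega
  · exact Or.inl (by omega)
end
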